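/- Let λ be a labeled polytree sequent with label w occurring in λ. For any two w-partitions λ1 ⊗_w λ2 and λ1' ⊗_w λ2' of λ, the display sequents D_w(λ1 ⊗_w λ2) and D_w(λ1' ⊗_w λ2') are deductively equivalent, i.e. mutually derivable from one another in DKtP. -/

import Mathlib

set_option linter.unusedVariables false

/-- Formulae of the tense language `L`. -/
inductive Fm : Type where
  | atom : Nat → Fm
  | top : Fm
  | bot : Fm
  | neg : Fm → Fm
  | or : Fm → Fm → Fm
  | and : Fm → Fm → Fm
  | imp : Fm → Fm → Fm
  | box : Fm → Fm
  | dia : Fm → Fm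
  | boxP : Fm → Fm
  | diaP : Fm → Fm
deriving DecidableEq

instance : Inhabited Fm := ⟨Fm.top⟩

/-- The language `L_{∧,◇,♦}`. -/
inductive SimpFm : Fm → Prop where
  | atom (p : Nat) : SimpFm (.atom p)
  | top : SimpFm .top
  | and {A B : Fm} : SimpFm A → SimpFm B → SimpFm (.and A B)
  | dia {A : Fm} : SimpFm A → SimpFm (.dia A)
  | diaP {A : Fm} : SimpFm A → SimpFm (.diaP A)

/-- The grammar `A ::= p | ⊤ | (A∧A) | (A∨A) | ◇A | ♦A` of primitive tense axioms. -/
inductive PrimFm : Fm → Prop where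
  | atom (p : Nat) : PrimFm (.atom p)
  | top : PrimFm .top
  | and {A B : Fm} : PrimFm A → PrimFm B → PrimFm (.and A B)
  | or {A B : Fm} : PrimFm A → PrimFm B → PrimFm (.or A B)
  | dia {A : Fm} : PrimFm A → PrimFm (.dia A)
  | diaP {A : Fm} : PrimFm A → PrimFm (.diaP A)

/-- Number of occurrences of the atom `p` in a formula. -/
def atomCount : Fm → Nat → Nat
  | .atom q, p => if q = p then 1 else 0
  | .top, _ => 0
  | .bot, _ => 0
  | .neg A, p => atomCount A p
  | .or A B, p => atomCount A p + atomCount B p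
  | .and A B, p => atomCount A p + atomCount B p
  | .imp A B, p => atomCount A p + atomCount B p
  | .box A, p => atomCount A p
  | .dia A, p => atomCount A p
  | .boxP A, p => atomCount A p
  | .diaP A, p => atomCount A p

/-- `A` contains each propositional atom at most once. -/
def AtomsOnce (A : Fm) : Prop := ∀ p, atomCount A p ≤ 1

/-- A simplified primitive tense axiom, encoded as its antecedent together with the
(nonempty) list of its disjuncts. -/
def ValidAx (x : Fm × List Fm) : Prop :=
  SimpFm x.1 ∧ AtomsOnce x.1 ∧ x.2 ≠ [] ∧ ∀ B ∈ x.2, SimpFm B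

/-- A set of simplified primitive tense axioms. -/
def ValidAxSet (P : Set (Fm × List Fm)) : Prop := ∀ x ∈ P, ValidAx x

/-- Display structures `X ::= A | I | *X | •X | (X∘X)`. -/
inductive Str : Type where
  | fm : Fm → Str
  | I : Str
  | star : Str → Str
  | bullet : Str → Str
  | comp : Str → Str → Str
deriving DecidableEq

/-- Display sequents `X ⊢ Y`. -/
structure DSeq : Type where
  ant : Str
  suc : Str
deriving DecidableEq

/-- Length of a structure. -/
def Str.len : Str → Nat
  | .fm _ => 1
  | .I => 1
  | .star X => X.len + 1
  | .bullet X => X.len + 1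
  | .comp X Y => X.len + Y.len + 1

/-- Length of a display sequent. -/
def DSeq.len (d : DSeq) : Nat := d.ant.len + d.suc.len

/-- The translation `ψ` from formulae of `L_{∧,◇,♦}` to (schematic) structures, where the
structure variable `Ẋ_p` for each atom `p` is instantiated by `θ p`. -/
def psiStr (θ : Nat → Str) : Fm → Str
  | .atom p => θ p
  | .top => .I
  | .and A B => .comp (psiStr θ A) (psiStr θ B)
  | .dia A => .star (.bullet (.star (psiStr θ A)))
  | .diaP A => .bullet (psiStr θ A)
  | _ => .I

/-- Labeled sequents `R, Γ ⇒ Δ`: a set of relational atoms together with multisets of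
labeled formulae on the left and on the right. -/
structure LSeq : Type where
  rel : Finset (Nat × Nat)
  ant : Multiset (Nat × Fm)
  suc : Multiset (Nat × Fm)

/-- The empty labeled sequent. -/
def LSeq.empty : LSeq := ⟨∅, 0, 0⟩
instance : Inhabited LSeq := ⟨LSeq.empty⟩

/-- Sequent composition `⊗`. -/
def LSeq.comp (s t : LSeq) : LSeq := ⟨s.rel ∪ t.rel, s.ant + t.ant, s.suc + t.suc⟩

/-- The labeled sequent `w : A ⇒ ∅`. -/
def Fq (w : Nat) (A : Fm) : LSeq := ⟨∅, {(w, A)}, 0⟩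
/-- The labeled sequent `∅ ⇒ w : A`. -/
def Gq (w : Nat) (A : Fm) : LSeq := ⟨∅, 0, {(w, A)}⟩
/-- The labeled sequent `Rwu ⇒ ∅`. -/
def Rl (w u : Nat) : LSeq := ⟨{(w, u)}, 0, 0⟩

/-- The labels occurring in a labeled sequent. -/
def LSeq.labels (s : LSeq) : Finset Nat :=
  s.rel.image Prod.fst ∪ s.rel.image Prod.snd ∪
    (s.ant.map Prod.fst).toFinset ∪ (s.suc.map Prod.fst).toFinset

/-- The length `|R| + |Γ| + |Δ|` of a labeled sequent. -/
def LSeq.len (s : LSeq) : Nat := s.rel.card + Multiset.card s.ant + Multiset.card s.suc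

/-- Applying a label substitution to a labeled sequent. -/
def LSeq.rename (f : Nat → Nat) (s : LSeq) : LSeq :=
  ⟨s.rel.image (fun e => (f e.1, f e.2)),
   s.ant.map (fun x => (f x.1, x.2)),
   s.suc.map (fun x => (f x.1, x.2))⟩

/-- The (undirected simple) graph of a labeled sequent: labels as vertices, and an edge
between `a` and `b` for each relational atom `Rab`. -/
def LSeq.graph (s : LSeq) : SimpleGraph Nat :=
  SimpleGraph.fromRel (fun a b => (a, b) ∈ s.rel)

/-- `s` is a labeled polytree sequent: (1) if `R = ∅` then `s` is `w`-flat for some `w`;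
(2) if `R ≠ ∅` then every label of `Γ, Δ` occurs in `R`; (3) the graph of `s` is connected
and free of directed and undirected cycles. -/
def IsPolytree (s : LSeq) : Prop :=
  (s.rel = ∅ → ∃ w, (∀ x ∈ s.ant, x.1 = w) ∧ (∀ x ∈ s.suc, x.1 = w)) ∧
  (s.rel ≠ ∅ →
    (∀ x ∈ s.ant, x.1 ∈ s.rel.image Prod.fst ∪ s.rel.image Prod.snd) ∧
    (∀ x ∈ s.suc, x.1 ∈ s.rel.image Prod.fst ∪ s.rel.image Prod.snd)) ∧
  (∀ a, (a, a) ∉ s.rel) ∧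
  (∀ a b, (a, b) ∈ s.rel → (b, a) ∉ s.rel) ∧
  s.graph.IsAcyclic ∧
  (∀ a ∈ s.labels, ∀ b ∈ s.labels, s.graph.Reachable a b)

/-- Isomorphism of labeled sequents: a bijection between the label sets preserving and
reflecting relational atoms and labeled formulae on each side. -/
def LSeq.Iso (s t : LSeq) : Prop :=
  ∃ f : Nat → Nat, Set.BijOn f ↑s.labels ↑t.labels ∧
    (∀ a b, (a, b) ∈ s.rel → (f a, f b) ∈ t.rel) ∧
    (∀ a b, a ∈ s.labels → b ∈ s.labels → (f a, f b) ∈ t.rel → (a, b) ∈ s.rel) ∧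
    (∀ a A, (a, A) ∈ s.ant → (f a, A) ∈ t.ant) ∧
    (∀ a A, a ∈ s.labels → (f a, A) ∈ t.ant → (a, A) ∈ s.ant) ∧
    (∀ a A, (a, A) ∈ s.suc → (f a, A) ∈ t.suc) ∧
    (∀ a A, a ∈ s.labels → (f a, A) ∈ t.suc → (a, A) ∈ s.suc)

/-- The rules of Kracht's display calculus `DKtP` for the primitive tense logic
axiomatized by the set `P` of simplified primitive tense axioms, given as a relation
between the list of premises and the conclusion. -/
inductive DRule (P : Set (Fm × List Fm)) : List DSeq → DSeq → Prop where
  | id (p : Nat) : DRule P [] ⟨.fm (.atom p), .fm (.atom p)⟩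
  | topR : DRule P [] ⟨.I, .fm .top⟩
  | botL : DRule P [] ⟨.fm .bot, .I⟩
  | topL (Y : Str) : DRule P [⟨.I, Y⟩] ⟨.fm .top, Y⟩
  | botR (X : Str) : DRule P [⟨X, .I⟩] ⟨X, .fm .bot⟩
  | negL (A : Fm) (Y : Str) : DRule P [⟨.star (.fm A), Y⟩] ⟨.fm (.neg A), Y⟩
  | negR (A : Fm) (X : Str) : DRule P [⟨X, .star (.fm A)⟩] ⟨X, .fm (.neg A)⟩
  | impR (A B : Fm) (X : Str) : DRule P [⟨.comp X (.fm A), .fm B⟩] ⟨X, .fm (.imp A B)⟩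
  | impL (A B : Fm) (X Y : Str) :
      DRule P [⟨X, .fm A⟩, ⟨.fm B, Y⟩] ⟨.fm (.imp A B), .comp (.star X) Y⟩
  | orR (A B : Fm) (X : Str) : DRule P [⟨X, .comp (.fm A) (.fm B)⟩] ⟨X, .fm (.or A B)⟩
  | orL (A B : Fm) (Y : Str) : DRule P [⟨.fm A, Y⟩, ⟨.fm B, Y⟩] ⟨.fm (.or A B), Y⟩
  | andL (A B : Fm) (Y : Str) : DRule P [⟨.comp (.fm A) (.fm B), Y⟩] ⟨.fm (.and A B), Y⟩
  | andR (A B : Fm) (X : Str) : DRule P [⟨X, .fm A⟩, ⟨X, .fm B⟩] ⟨X, .fm (.and A B)⟩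
  | boxL (A : Fm) (Y : Str) : DRule P [⟨.fm A, Y⟩] ⟨.fm (.box A), .bullet Y⟩
  | boxR (A : Fm) (X : Str) : DRule P [⟨.bullet X, .fm A⟩] ⟨X, .fm (.box A)⟩
  | diaL (A : Fm) (Y : Str) :
      DRule P [⟨.fm A, .star (.bullet (.star Y))⟩] ⟨.fm (.dia A), Y⟩
  | diaR (A : Fm) (X : Str) :
      DRule P [⟨X, .fm A⟩] ⟨.star (.bullet (.star X)), .fm (.dia A)⟩
  | boxPR (A : Fm) (X : Str) :
      DRule P [⟨.star (.bullet (.star X)), .fm A⟩] ⟨X, .fm (.boxP A)⟩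
  | boxPL (A : Fm) (Y : Str) :
      DRule P [⟨.fm A, Y⟩] ⟨.fm (.boxP A), .star (.bullet (.star Y))⟩
  | diaPL (A : Fm) (Y : Str) : DRule P [⟨.fm A, .bullet Y⟩] ⟨.fm (.diaP A), Y⟩
  | diaPR (A : Fm) (X : Str) : DRule P [⟨X, .fm A⟩] ⟨.bullet X, .fm (.diaP A)⟩
  | d1a (X Y Z : Str) : DRule P [⟨.comp X Y, Z⟩] ⟨X, .comp Z (.star Y)⟩
  | d1b (X Y Z : Str) : DRule P [⟨X, .comp Z (.star Y)⟩] ⟨.comp X Y, Z⟩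
  | d2a (X Y Z : Str) : DRule P [⟨.comp X Y, Z⟩] ⟨Y, .comp (.star X) Z⟩
  | d2b (X Y Z : Str) : DRule P [⟨Y, .comp (.star X) Z⟩] ⟨.comp X Y, Z⟩
  | d3a (X Y Z : Str) : DRule P [⟨X, .comp Y Z⟩] ⟨.comp X (.star Z), Y⟩
  | d3b (X Y Z : Str) : DRule P [⟨.comp X (.star Z), Y⟩] ⟨X, .comp Y Z⟩
  | d4a (X Y Z : Str) : DRule P [⟨X, .comp Y Z⟩] ⟨.comp (.star Y) X, Z⟩
  | d4b (X Y Z : Str) : DRule P [⟨.comp (.star Y) X, Z⟩] ⟨X, .comp Y Z⟩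
  | d5a (X Y : Str) : DRule P [⟨.star X, Y⟩] ⟨.star Y, X⟩
  | d5b (X Y : Str) : DRule P [⟨.star Y, X⟩] ⟨.star X, Y⟩
  | d6a (X Y : Str) : DRule P [⟨X, .star Y⟩] ⟨Y, .star X⟩
  | d6b (X Y : Str) : DRule P [⟨Y, .star X⟩] ⟨X, .star Y⟩
  | d7a (X Y : Str) : DRule P [⟨.star (.star X), Y⟩] ⟨X, Y⟩
  | d7b (X Y : Str) : DRule P [⟨X, Y⟩] ⟨.star (.star X), Y⟩
  | d8a (X Y : Str) : DRule P [⟨X, .star (.star Y)⟩] ⟨X, Y⟩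
  | d8b (X Y : Str) : DRule P [⟨X, Y⟩] ⟨X, .star (.star Y)⟩
  | d9a (X Y : Str) : DRule P [⟨X, .bullet Y⟩] ⟨.bullet X, Y⟩
  | d9b (X Y : Str) : DRule P [⟨.bullet X, Y⟩] ⟨X, .bullet Y⟩
  | ila (X Y : Str) : DRule P [⟨X, Y⟩] ⟨.comp .I X, Y⟩
  | ilb (X Y : Str) : DRule P [⟨.comp .I X, Y⟩] ⟨X, Y⟩
  | ira (X Y : Str) : DRule P [⟨X, Y⟩] ⟨X, .comp .I Y⟩
  | irb (X Y : Str) : DRule P [⟨X, .comp .I Y⟩] ⟨X, Y⟩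
  | qla (Y : Str) : DRule P [⟨.I, Y⟩] ⟨.star .I, Y⟩
  | qlb (Y : Str) : DRule P [⟨.star .I, Y⟩] ⟨.I, Y⟩
  | qra (X : Str) : DRule P [⟨X, .I⟩] ⟨X, .star .I⟩
  | qrb (X : Str) : DRule P [⟨X, .star .I⟩] ⟨X, .I⟩
  | wl (X Y Z : Str) : DRule P [⟨X, Y⟩] ⟨.comp Z X, Y⟩
  | wr (X Y Z : Str) : DRule P [⟨X, Y⟩] ⟨X, .comp Y Z⟩
  | ala (X Y Z W : Str) : DRule P [⟨.comp X (.comp Y Z), W⟩] ⟨.comp (.comp X Y) Z, W⟩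
  | alb (X Y Z W : Str) : DRule P [⟨.comp (.comp X Y) Z, W⟩] ⟨.comp X (.comp Y Z), W⟩
  | ara (X Y Z W : Str) : DRule P [⟨X, .comp Y (.comp Z W)⟩] ⟨X, .comp (.comp Y Z) W⟩
  | arb (X Y Z W : Str) : DRule P [⟨X, .comp (.comp Y Z) W⟩] ⟨X, .comp Y (.comp Z W)⟩
  | pl (X Y Z : Str) : DRule P [⟨.comp X Y, Z⟩] ⟨.comp Y X, Z⟩
  | pr (X Y Z : Str) : DRule P [⟨X, .comp Y Z⟩] ⟨X, .comp Z Y⟩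
  | cl (X Y : Str) : DRule P [⟨.comp X X, Y⟩] ⟨X, Y⟩
  | cr (X Y : Str) : DRule P [⟨X, .comp Y Y⟩] ⟨X, Y⟩
  | ml (Y : Str) : DRule P [⟨.I, Y⟩] ⟨.bullet .I, Y⟩
  | mr (X : Str) : DRule P [⟨X, .I⟩] ⟨X, .bullet .I⟩
  | cut (A : Fm) (X Y : Str) : DRule P [⟨X, .fm A⟩, ⟨.fm A, Y⟩] ⟨X, Y⟩
  | pt (A : Fm) (Bs : List Fm) (θ : Nat → Str) (X : Str) :
      (A, Bs) ∈ P →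
      DRule P (Bs.map (fun B => ⟨psiStr θ B, X⟩)) ⟨psiStr θ A, X⟩

/-- Derivability in the display calculus `DKtP` from a set `H` of hypothesis sequents. -/
inductive DPH (P : Set (Fm × List Fm)) (H : Set DSeq) : DSeq → Prop where
  | hyp {d : DSeq} : d ∈ H → DPH P H d
  | node {prems : List DSeq} {concl : DSeq} :
      DRule P prems concl → (∀ p ∈ prems, DPH P H p) → DPH P H concl

/-- `IsComp ms X` holds when the structure `X` is a `∘`-composition of exactly the
formulae in the multiset `ms` (being `I` when `ms` is empty). -/
inductive IsComp : Multiset Fm → Str → Prop where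
  | nil : IsComp 0 .I
  | single (A : Fm) : IsComp {A} (.fm A)
  | comp {s t : Multiset Fm} {X Y : Str} :
      IsComp s X → IsComp t Y → IsComp (s + t) (.comp X Y)

/-- `DT1 λ w X` holds when `X` is a result of the translation `D^w_1` applied to the
labeled polytree sequent `λ` rooted at `w`: formulae labeled `w` are rendered as
`(Γ↾w) ∘ *(Δ↾w)`, a subpolytree attached by an outgoing edge `Rwu` is rendered via
`*•*D^u_1`, and a subpolytree attached by an incoming edge `Rvw` is rendered via
`•D^v_1`. -/
inductive DT1 : LSeq → Nat → Str → Prop where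
  | flat {Γ Δ : Multiset Fm} {X Y : Str} (w : Nat) :
      IsComp Γ X → IsComp Δ Y →
      DT1 ⟨∅, Γ.map (fun A => (w, A)), Δ.map (fun A => (w, A))⟩ w (.comp X (.star Y))
  | out {s t : LSeq} {w u : Nat} {X Y : Str} :
      DT1 s w X → DT1 t u Y → w ≠ u → w ∉ t.labels → u ∉ s.labels →
      s.labels ∩ t.labels = ∅ →
      DT1 (s.comp ((Rl w u).comp t)) w (.comp X (.star (.bullet (.star Y))))
  | inn {s t : LSeq} {w v : Nat} {X Y : Str} :
      DT1 s w X → DT1 t v Y → w ≠ v → w ∉ t.labels → v ∉ s.labels →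
      s.labels ∩ t.labels = ∅ →
      DT1 (s.comp ((Rl v w).comp t)) w (.comp X (.bullet Y))
  | glue {s t : LSeq} {w : Nat} {X Y : Str} :
      DT1 s w X → DT1 t w Y → s.labels ∩ t.labels ⊆ {w} →
      DT1 (s.comp t) w (.comp X Y)

/-- `DT2 λ w X` holds when `X` is a result of the translation `D^w_2` (dual to `D^w_1`)
applied to the labeled polytree sequent `λ` rooted at `w`. -/
inductive DT2 : LSeq → Nat → Str → Prop where
  | flat {Γ Δ : Multiset Fm} {X Y : Str} (w : Nat) :
      IsComp Γ X → IsComp Δ Y →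
      DT2 ⟨∅, Γ.map (fun A => (w, A)), Δ.map (fun A => (w, A))⟩ w (.comp (.star X) Y)
  | out {s t : LSeq} {w u : Nat} {X Y : Str} :
      DT2 s w X → DT2 t u Y → w ≠ u → w ∉ t.labels → u ∉ s.labels →
      s.labels ∩ t.labels = ∅ →
      DT2 (s.comp ((Rl w u).comp t)) w (.comp X (.bullet Y))
  | inn {s t : LSeq} {w v : Nat} {X Y : Str} :
      DT2 s w X → DT2 t v Y → w ≠ v → w ∉ t.labels → v ∉ s.labels →
      s.labels ∩ t.labels = ∅ →
      DT2 (s.comp ((Rl v w).comp t)) w (.comp X (.star (.bullet (.star Y))))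
  | glue {s t : LSeq} {w : Nat} {X Y : Str} :
      DT2 s w X → DT2 t w Y → s.labels ∩ t.labels ⊆ {w} →
      DT2 (s.comp t) w (.comp X Y)

/-- `λ1 ⊗_w λ2` is a `w`-partition of `λ`: `λ = λ1 ⊗ λ2` with `λ1, λ2` labeled polytree
sequents whose label sets intersect exactly in `{w}`. -/
def WPart (lam s t : LSeq) (w : Nat) : Prop :=
  lam = s.comp t ∧ IsPolytree s ∧ IsPolytree t ∧ s.labels ∩ t.labels = {w}

/-- `DTr λ w δ` holds when the display sequent `δ` is a result of the translation `D_w`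
applied to `λ`: for some `w`-partition `λ = λ1 ⊗_w λ2`, the antecedent of `δ` is a result
of `D^w_1(λ1)` and the succedent a result of `D^w_2(λ2)`. -/
def DTr (lam : LSeq) (w : Nat) (d : DSeq) : Prop :=
  ∃ s t, WPart lam s t w ∧ DT1 s w d.ant ∧ DT2 t w d.suc

section Derivability

variable {P : Set (Fm × List Fm)} {H : Set DSeq}

lemma DPH.of_rule {p c : DSeq} (r : DRule P [p] c) (h : DPH P H p) : DPH P H c :=
  .node r (by simpa using h)

lemma DPH.comp_iff {X Y Z : Str} :
    DPH P H ⟨.comp X Y, Z⟩ ↔ DPH P H ⟨X, .comp Z (.star Y)⟩ :=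
  ⟨.of_rule (.d1a ..), .of_rule (.d1b ..)⟩

lemma DPH.star_comm {X Y : Str} : DPH P H ⟨.star X, Y⟩ ↔ DPH P H ⟨.star Y, X⟩ :=
  ⟨.of_rule (.d5a ..), .of_rule (.d5b ..)⟩

lemma DPH.comm_star {X Y : Str} : DPH P H ⟨X, .star Y⟩ ↔ DPH P H ⟨Y, .star X⟩ :=
  ⟨.of_rule (.d6a ..), .of_rule (.d6b ..)⟩

lemma DPH.star_star_left {X Y : Str} : DPH P H ⟨.star (.star X), Y⟩ ↔ DPH P H ⟨X, Y⟩ :=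
  ⟨.of_rule (.d7a ..), .of_rule (.d7b ..)⟩

lemma DPH.star_star_right {X Y : Str} : DPH P H ⟨X, .star (.star Y)⟩ ↔ DPH P H ⟨X, Y⟩ :=
  ⟨.of_rule (.d8a ..), .of_rule (.d8b ..)⟩

lemma DPH.bullet_iff {X Y : Str} : DPH P H ⟨.bullet X, Y⟩ ↔ DPH P H ⟨X, .bullet Y⟩ :=
  ⟨.of_rule (.d9b ..), .of_rule (.d9a ..)⟩

lemma DPH.swap_left {X Y Z : Str} : DPH P H ⟨.comp X Y, Z⟩ ↔ DPH P H ⟨.comp Y X, Z⟩ :=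
  ⟨.of_rule (.pl ..), .of_rule (.pl ..)⟩

lemma DPH.assoc_left {X Y Z W : Str} :
    DPH P H ⟨.comp (.comp X Y) Z, W⟩ ↔ DPH P H ⟨.comp X (.comp Y Z), W⟩ :=
  ⟨.of_rule (.alb ..), .of_rule (.ala ..)⟩

lemma DPH.comp_I_left {X Y : Str} : DPH P H ⟨.comp .I X, Y⟩ ↔ DPH P H ⟨X, Y⟩ :=
  ⟨.of_rule (.ilb ..), .of_rule (.ila ..)⟩

/-- Every sequent is interderivable with one whose succedent is `I`. -/
lemma DPH.iff_comp_star_I {X Y : Str} :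
    DPH P H ⟨X, Y⟩ ↔ DPH P H ⟨.comp X (.star Y), .I⟩ :=
  ⟨fun h => .of_rule (.d3a ..) (.of_rule (.ira ..) h),
   fun h => .of_rule (.irb ..) (.of_rule (.d3b ..) h)⟩

lemma DPH.dia_iff {X Y : Str} :
    DPH P H ⟨.star (.bullet (.star X)), Y⟩ ↔ DPH P H ⟨X, .star (.bullet (.star Y))⟩ := by
  rw [DPH.star_comm, ← DPH.bullet_iff, DPH.comm_star]

lemma DPH.star_comp {X Y Z : Str} :
    DPH P H ⟨.star (.comp X Y), Z⟩ ↔ DPH P H ⟨.comp (.star X) (.star Y), Z⟩ := by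
  have h : DPH P H ⟨.star Z, .comp X Y⟩ ↔ DPH P H ⟨.comp (.star X) (.star Z), Y⟩ :=
    ⟨.of_rule (.d4a ..), .of_rule (.d4b ..)⟩
  rw [DPH.star_comm, h, DPH.iff_comp_star_I, DPH.assoc_left, DPH.swap_left, DPH.comp_iff,
    DPH.swap_left, ← DPH.comp_iff, DPH.swap_left, ← DPH.assoc_left, ← DPH.iff_comp_star_I]

end Derivability

/-- Interderivability of structures in antecedent position. -/
def antSetoid (P : Set (Fm × List Fm)) (H : Set DSeq) : Setoid Str where
  r X Y := ∀ Z, DPH P H ⟨X, Z⟩ ↔ DPH P H ⟨Y, Z⟩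
  iseqv := ⟨fun _ _ => Iff.rfl, fun h Z => (h Z).symm, fun h k Z => (h Z).trans (k Z)⟩

/-- Structures up to interderivability in antecedent position. -/
def AntQuot (P : Set (Fm × List Fm)) (H : Set DSeq) : Type := Quotient (antSetoid P H)

namespace AntQuot

variable {P : Set (Fm × List Fm)} {H : Set DSeq}

/-- The class of a structure. -/
def mk (P : Set (Fm × List Fm)) (H : Set DSeq) (X : Str) : AntQuot P H :=
  Quotient.mk (antSetoid P H) X

lemma mk_eq_iff {X Y : Str} :
    mk P H X = mk P H Y ↔ ∀ Z, DPH P H ⟨X, Z⟩ ↔ DPH P H ⟨Y, Z⟩ :=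
  Quotient.eq (r := antSetoid P H)

lemma mk_comp_congr {X X' Y Y' : Str} (hX : mk P H X = mk P H X')
    (hY : mk P H Y = mk P H Y') : mk P H (.comp X Y) = mk P H (.comp X' Y') := by
  rw [mk_eq_iff] at *
  intro Z
  rw [DPH.comp_iff, hX, ← DPH.comp_iff, DPH.swap_left, DPH.comp_iff, hY, ← DPH.comp_iff,
    DPH.swap_left]

instance : CommMonoid (AntQuot P H) where
  mul := Quotient.map₂ (sa := antSetoid P H) (sb := antSetoid P H) (sc := antSetoid P H)
    Str.comp fun _ _ hX _ _ hY =>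
      mk_eq_iff.1 (mk_comp_congr (mk_eq_iff.2 hX) (mk_eq_iff.2 hY))
  one := mk P H .I
  mul_assoc := by
    rintro ⟨X⟩ ⟨Y⟩ ⟨Z⟩
    exact mk_eq_iff.2 fun _ => DPH.assoc_left
  mul_comm := by
    rintro ⟨X⟩ ⟨Y⟩
    exact mk_eq_iff.2 fun _ => DPH.swap_left
  one_mul := by
    rintro ⟨X⟩
    exact mk_eq_iff.2 fun _ => DPH.comp_I_left
  mul_one := by
    rintro ⟨X⟩
    exact mk_eq_iff.2 fun _ => DPH.swap_left.trans DPH.comp_I_left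

lemma mk_comp (X Y : Str) : mk P H (.comp X Y) = mk P H X * mk P H Y := rfl

lemma mk_I : mk P H .I = 1 := rfl

lemma mk_star_I : mk P H (.star .I) = 1 :=
  mk_eq_iff.2 fun _ => ⟨.of_rule (.qlb ..), .of_rule (.qla ..)⟩

lemma mk_star_star (X : Str) : mk P H (.star (.star X)) = mk P H X :=
  mk_eq_iff.2 fun _ => DPH.star_star_left

lemma mk_star_comp (X Y : Str) :
    mk P H (.star (.comp X Y)) = mk P H (.star X) * mk P H (.star Y) :=
  mk_eq_iff.2 fun _ => DPH.star_comp

/-- The operation induced by `X ↦ •X`. -/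
def past : AntQuot P H → AntQuot P H :=
  Quotient.map (sa := antSetoid P H) (sb := antSetoid P H) Str.bullet fun _ _ h _ => by
    rw [DPH.bullet_iff, h, DPH.bullet_iff]

/-- The operation induced by `X ↦ *•*X`. -/
def future : AntQuot P H → AntQuot P H :=
  Quotient.map (sa := antSetoid P H) (sb := antSetoid P H)
    (fun X => .star (.bullet (.star X))) fun _ _ h _ => by
    rw [DPH.dia_iff, h, DPH.dia_iff]

lemma mk_bullet (X : Str) : mk P H (.bullet X) = past (mk P H X) := rfl

lemma mk_dia (X : Str) : mk P H (.star (.bullet (.star X))) = future (mk P H X) := rfl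

lemma mk_star_bullet (X : Str) : mk P H (.star (.bullet X)) = future (mk P H (.star X)) := by
  rw [← mk_dia, mk_eq_iff]
  intro Z
  rw [DPH.dia_iff, DPH.comm_star, DPH.star_star_right, DPH.star_comm, ← DPH.bullet_iff]

lemma mk_of_isComp {ms : Multiset Fm} {X : Str} (h : IsComp ms X) :
    mk P H X = (ms.map fun A => mk P H (.fm A)).prod := by
  induction h with
  | nil => rfl
  | single A => simp
  | comp _ _ ihs iht => simp [mk_comp, ihs, iht]

lemma mk_star_of_isComp {ms : Multiset Fm} {X : Str} (h : IsComp ms X) :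
    mk P H (.star X) = (ms.map fun A => mk P H (.star (.fm A))).prod := by
  induction h with
  | nil => simp [mk_star_I]
  | single A => simp
  | comp _ _ ihs iht => simp [mk_star_comp, ihs, iht]

/-- A translation `D^w_2` is, under `*`, equivalent to some translation `D^w_1`. -/
lemma exists_dt1_of_dt2 {t : LSeq} {w : Nat} {Y : Str} (h : DT2 t w Y) :
    ∃ X, DT1 t w X ∧ mk P H (.star Y) = mk P H X := by
  induction h with
  | flat w hX hY =>
    exact ⟨_, .flat w hX hY, by rw [mk_star_comp, mk_star_star, mk_comp]⟩
  | out _ _ h₁ h₂ h₃ h₄ ihs iht =>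
    obtain ⟨X, hX, eX⟩ := ihs
    obtain ⟨Y, hY, eY⟩ := iht
    exact ⟨_, .out hX hY h₁ h₂ h₃ h₄, by
      rw [mk_star_comp, mk_star_bullet, eX, eY, mk_comp, mk_dia]⟩
  | inn _ _ h₁ h₂ h₃ h₄ ihs iht =>
    obtain ⟨X, hX, eX⟩ := ihs
    obtain ⟨Y, hY, eY⟩ := iht
    exact ⟨_, .inn hX hY h₁ h₂ h₃ h₄, by
      rw [mk_star_comp, mk_star_star, mk_bullet, eX, eY, mk_comp, mk_bullet]⟩
  | glue _ _ h ihs iht =>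
    obtain ⟨X, hX, eX⟩ := ihs
    obtain ⟨Y, hY, eY⟩ := iht
    exact ⟨_, .glue hX hY h, by rw [mk_star_comp, eX, eY, mk_comp]⟩

end AntQuot

namespace LSeq

lemma fst_mem_labels {s : LSeq} {e : Nat × Nat} (h : e ∈ s.rel) : e.1 ∈ s.labels := by
  simp only [labels, Finset.mem_union, Finset.mem_image]
  exact .inl (.inl (.inl ⟨e, h, rfl⟩))

lemma snd_mem_labels {s : LSeq} {e : Nat × Nat} (h : e ∈ s.rel) : e.2 ∈ s.labels := by
  simp only [labels, Finset.mem_union, Finset.mem_image]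
  exact .inl (.inl (.inr ⟨e, h, rfl⟩))

lemma ant_mem_labels {s : LSeq} {x : Nat × Fm} (h : x ∈ s.ant) : x.1 ∈ s.labels := by
  simp only [labels, Finset.mem_union, Multiset.mem_toFinset, Multiset.mem_map]
  exact .inl (.inr ⟨x, h, rfl⟩)

lemma suc_mem_labels {s : LSeq} {x : Nat × Fm} (h : x ∈ s.suc) : x.1 ∈ s.labels := by
  simp only [labels, Finset.mem_union, Multiset.mem_toFinset, Multiset.mem_map]
  exact .inr ⟨x, h, rfl⟩

lemma comp_comm (s t : LSeq) : s.comp t = t.comp s := by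
  simp [comp, Finset.union_comm, add_comm]

lemma labels_comp (s t : LSeq) : (s.comp t).labels = s.labels ∪ t.labels := by
  ext x
  simp only [labels, comp, Finset.image_union, Multiset.map_add, Multiset.toFinset_add,
    Finset.mem_union]
  tauto

lemma labels_Rl (w u : Nat) : (Rl w u).labels = {w, u} := by
  ext x
  simp [labels, Rl]

section Value

variable {M : Type*} [CommMonoid M] (a b : Fm → M) (f g : M → M)

/-- The value at `w` of the formulae labeled `w`. -/
def flatValue (s : LSeq) (w : Nat) : M :=
  ((s.ant.filter (·.1 = w)).map fun x => a x.2).prod *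
    ((s.suc.filter (·.1 = w)).map fun x => b x.2).prod

/-- The value at `w` of a labeled sequent explored up to depth `n` while avoiding the labels
in `D`. -/
def value (s : LSeq) : Nat → Finset Nat → Nat → M
  | 0, _, _ => 1
  | n + 1, D, w =>
    s.flatValue a b w *
      ((∏ e ∈ s.rel with e.1 = w ∧ e.2 ∉ insert w D, f (value s n (insert w D) e.2)) *
       ∏ e ∈ s.rel with e.2 = w ∧ e.1 ∉ insert w D, g (value s n (insert w D) e.1))

/-- The value at a label only depends on the part of the sequent which is accessible from it
without passing through `D`. -/
lemma value_congr {s t : LSeq} {D : Finset Nat} {S : Set Nat}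
    (hflat : ∀ x ∈ S, s.flatValue a b x = t.flatValue a b x)
    (hout : ∀ x ∈ S, ∀ y ∉ D, ((x, y) ∈ s.rel ↔ (x, y) ∈ t.rel) ∧ ((x, y) ∈ s.rel → y ∈ S))
    (hinn : ∀ x ∈ S, ∀ y ∉ D, ((y, x) ∈ s.rel ↔ (y, x) ∈ t.rel) ∧ ((y, x) ∈ s.rel → y ∈ S))
    (n : Nat) {D' : Finset Nat} (hD : D ⊆ D') {x : Nat} (hx : x ∈ S) :
    s.value a b f g n D' x = t.value a b f g n D' x := by
  induction n generalizing D' x with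
  | zero => rfl
  | succ n ih =>
    have hD' : D ⊆ insert x D' := hD.trans (Finset.subset_insert _ _)
    simp only [value]
    rw [hflat x hx]
    congr 2
    · refine Finset.prod_congr ?_ ?_
      · ext ⟨y, z⟩
        simp only [Finset.mem_filter]
        constructor
        · rintro ⟨h, rfl, hz⟩
          exact ⟨(hout _ hx z fun h' => hz (hD' h')).1.1 h, rfl, hz⟩
        · rintro ⟨h, rfl, hz⟩
          exact ⟨(hout _ hx z fun h' => hz (hD' h')).1.2 h, rfl, hz⟩
      · rintro ⟨y, z⟩ h
        simp only [Finset.mem_filter] at h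
        obtain ⟨h, rfl, hz⟩ := h
        have hz' : z ∉ D := fun h' => hz (hD' h')
        rw [ih hD' ((hout _ hx z hz').2 ((hout _ hx z hz').1.2 h))]
    · refine Finset.prod_congr ?_ ?_
      · ext ⟨z, y⟩
        simp only [Finset.mem_filter]
        constructor
        · rintro ⟨h, rfl, hz⟩
          exact ⟨(hinn _ hx z fun h' => hz (hD' h')).1.1 h, rfl, hz⟩
        · rintro ⟨h, rfl, hz⟩
          exact ⟨(hinn _ hx z fun h' => hz (hD' h')).1.2 h, rfl, hz⟩
      · rintro ⟨z, y⟩ h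
        simp only [Finset.mem_filter] at h
        obtain ⟨h, rfl, hz⟩ := h
        have hz' : z ∉ D := fun h' => hz (hD' h')
        rw [ih hD' ((hinn _ hx z hz').2 ((hinn _ hx z hz').1.2 h))]

lemma flatValue_comp (s t : LSeq) (w : Nat) :
    (s.comp t).flatValue a b w = s.flatValue a b w * t.flatValue a b w := by
  simp only [flatValue, comp, Multiset.filter_add, Multiset.map_add, Multiset.prod_add]
  exact mul_mul_mul_comm _ _ _ _

lemma flatValue_of_notMem {s : LSeq} {w : Nat} (h : w ∉ s.labels) : s.flatValue a b w = 1 := by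
  have h₁ : s.ant.filter (·.1 = w) = 0 :=
    Multiset.filter_eq_nil.2 fun x hx e => h (e ▸ ant_mem_labels hx)
  have h₂ : s.suc.filter (·.1 = w) = 0 :=
    Multiset.filter_eq_nil.2 fun x hx e => h (e ▸ suc_mem_labels hx)
  simp [flatValue, h₁, h₂]

lemma flatValue_Rl (w u x : Nat) : (Rl w u).flatValue a b x = 1 := by
  simp [flatValue, Rl]

lemma value_comp_left {s t : LSeq} {D : Finset Nat} (hD : s.labels ∩ t.labels ⊆ D) (n : Nat)
    {x : Nat} (hx : x ∉ t.labels) :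
    (s.comp t).value a b f g n D x = s.value a b f g n D x := by
  have hS : ∀ y ∉ D, y ∈ s.labels → y ∉ t.labels := fun y hy h h' =>
    hy (hD (Finset.mem_inter.2 ⟨h, h'⟩))
  refine value_congr a b f g (S := {x | x ∉ t.labels}) (D := D) ?_ ?_ ?_ n subset_rfl hx
  · intro y hy
    rw [flatValue_comp, flatValue_of_notMem a b hy, mul_one]
  · intro y hy z hz
    have h : (y, z) ∉ t.rel := fun h => hy (fst_mem_labels h)
    have h' : (y, z) ∈ s.rel → z ∉ t.labels := fun h => hS z hz (snd_mem_labels h)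
    simpa [comp, h] using h'
  · intro y hy z hz
    have h : (z, y) ∉ t.rel := fun h => hy (snd_mem_labels h)
    have h' : (z, y) ∈ s.rel → z ∉ t.labels := fun h => hS z hz (fst_mem_labels h)
    simpa [comp, h] using h'

lemma value_comp_right {s t : LSeq} {D : Finset Nat} (hD : s.labels ∩ t.labels ⊆ D) (n : Nat)
    {x : Nat} (hx : x ∉ s.labels) :
    (s.comp t).value a b f g n D x = t.value a b f g n D x := by
  rw [comp_comm]
  exact value_comp_left a b f g (by rwa [Finset.inter_comm]) n hx

lemma value_comp {s t : LSeq} {w : Nat} (h : s.labels ∩ t.labels ⊆ {w}) (n : Nat)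
    (D : Finset Nat) :
    (s.comp t).value a b f g (n + 1) D w =
      s.value a b f g (n + 1) D w * t.value a b f g (n + 1) D w := by
  have hD : s.labels ∩ t.labels ⊆ insert w D := h.trans (by simp)
  have hS : ∀ y ∉ insert w D, y ∈ s.labels → y ∉ t.labels := fun y hy h h' =>
    hy (hD (Finset.mem_inter.2 ⟨h, h'⟩))
  have hT : ∀ y ∉ insert w D, y ∈ t.labels → y ∉ s.labels := fun y hy h h' => hS y hy h' h
  simp only [value]
  have hout : (∏ e ∈ (s.comp t).rel with e.1 = w ∧ e.2 ∉ insert w D,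
        f ((s.comp t).value a b f g n (insert w D) e.2)) =
      (∏ e ∈ s.rel with e.1 = w ∧ e.2 ∉ insert w D, f (s.value a b f g n (insert w D) e.2)) *
      ∏ e ∈ t.rel with e.1 = w ∧ e.2 ∉ insert w D, f (t.value a b f g n (insert w D) e.2) := by
    simp only [comp, Finset.filter_union]
    rw [Finset.prod_union]
    · congr 1
      · refine Finset.prod_congr rfl fun e he => ?_
        obtain ⟨he, -, hw⟩ := Finset.mem_filter.1 he
        exact congrArg f (value_comp_left a b f g hD n (hS _ hw (snd_mem_labels he)))
      · refine Finset.prod_congr rfl fun e he => ?_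
        obtain ⟨he, -, hw⟩ := Finset.mem_filter.1 he
        exact congrArg f (value_comp_right a b f g hD n (hT _ hw (snd_mem_labels he)))
    · refine Finset.disjoint_left.2 fun e he he' => ?_
      obtain ⟨he, -, hw⟩ := Finset.mem_filter.1 he
      exact hS _ hw (snd_mem_labels he) (snd_mem_labels (Finset.mem_filter.1 he').1)
  have hinn : (∏ e ∈ (s.comp t).rel with e.2 = w ∧ e.1 ∉ insert w D,
        g ((s.comp t).value a b f g n (insert w D) e.1)) =
      (∏ e ∈ s.rel with e.2 = w ∧ e.1 ∉ insert w D, g (s.value a b f g n (insert w D) e.1)) *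
      ∏ e ∈ t.rel with e.2 = w ∧ e.1 ∉ insert w D, g (t.value a b f g n (insert w D) e.1) := by
    simp only [comp, Finset.filter_union]
    rw [Finset.prod_union]
    · congr 1
      · refine Finset.prod_congr rfl fun e he => ?_
        obtain ⟨he, -, hw⟩ := Finset.mem_filter.1 he
        exact congrArg g (value_comp_left a b f g hD n (hS _ hw (fst_mem_labels he)))
      · refine Finset.prod_congr rfl fun e he => ?_
        obtain ⟨he, -, hw⟩ := Finset.mem_filter.1 he
        exact congrArg g (value_comp_right a b f g hD n (hT _ hw (fst_mem_labels he)))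
    · refine Finset.disjoint_left.2 fun e he he' => ?_
      obtain ⟨he, -, hw⟩ := Finset.mem_filter.1 he
      exact hS _ hw (fst_mem_labels he) (fst_mem_labels (Finset.mem_filter.1 he').1)
  rw [hout, hinn, flatValue_comp]
  ac_rfl

lemma value_Rl_comp_out {t : LSeq} {w u : Nat} {D : Finset Nat} (hwu : w ≠ u)
    (hw : w ∉ t.labels) (hu : u ∉ D) (n : Nat) :
    ((Rl w u).comp t).value a b f g (n + 1) D w = f (t.value a b f g n (insert w D) u) := by
  have key : ((Rl w u).comp t).value a b f g n (insert w D) u =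
      t.value a b f g n (insert w D) u := by
    refine value_congr a b f g (S := {x | x ≠ w}) (D := {w}) ?_ ?_ ?_ n (by simp) hwu.symm
    · intro y hy
      rw [flatValue_comp, flatValue_Rl, one_mul]
    · intro y hy z hz
      simp_all [comp, Rl]
    · intro y hy z hz
      simp_all [comp, Rl]
  have hout : (((Rl w u).comp t).rel.filter fun e => e.1 = w ∧ e.2 ∉ insert w D) =
      {(w, u)} := by
    ext e
    simp only [comp, Rl, Finset.mem_filter, Finset.mem_union, Finset.mem_singleton]
    constructor
    · rintro ⟨h | h, rfl, -⟩
      · exact h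
      · exact absurd (fst_mem_labels h) hw
    · rintro rfl
      simp [hu, hwu.symm]
  have hinn : (((Rl w u).comp t).rel.filter fun e => e.2 = w ∧ e.1 ∉ insert w D) = ∅ := by
    refine Finset.filter_eq_empty_iff.2 ?_
    intro e he
    simp only [comp, Rl, Finset.mem_union, Finset.mem_singleton] at he
    rintro ⟨h, -⟩
    rcases he with rfl | he
    · exact hwu h.symm
    · exact hw (h ▸ snd_mem_labels he)
  rw [value, hout, hinn, Finset.prod_singleton, Finset.prod_empty, flatValue_comp, flatValue_Rl,
    flatValue_of_notMem a b hw, key, mul_one, one_mul, mul_one]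

lemma value_Rl_comp_inn {t : LSeq} {w v : Nat} {D : Finset Nat} (hwv : w ≠ v)
    (hw : w ∉ t.labels) (hv : v ∉ D) (n : Nat) :
    ((Rl v w).comp t).value a b f g (n + 1) D w = g (t.value a b f g n (insert w D) v) := by
  have key : ((Rl v w).comp t).value a b f g n (insert w D) v =
      t.value a b f g n (insert w D) v := by
    refine value_congr a b f g (S := {x | x ≠ w}) (D := {w}) ?_ ?_ ?_ n (by simp) hwv.symm
    · intro y hy
      rw [flatValue_comp, flatValue_Rl, one_mul]
    · intro y hy z hz
      simp_all [comp, Rl]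
    · intro y hy z hz
      simp_all [comp, Rl]
  have hinn : (((Rl v w).comp t).rel.filter fun e => e.2 = w ∧ e.1 ∉ insert w D) =
      {(v, w)} := by
    ext e
    simp only [comp, Rl, Finset.mem_filter, Finset.mem_union, Finset.mem_singleton]
    constructor
    · rintro ⟨h | h, rfl, -⟩
      · exact h
      · exact absurd (snd_mem_labels h) hw
    · rintro rfl
      simp [hv, hwv.symm]
  have hout : (((Rl v w).comp t).rel.filter fun e => e.1 = w ∧ e.2 ∉ insert w D) = ∅ := by
    refine Finset.filter_eq_empty_iff.2 ?_
    intro e he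
    simp only [comp, Rl, Finset.mem_union, Finset.mem_singleton] at he
    rintro ⟨h, -⟩
    rcases he with rfl | he
    · exact hwv h.symm
    · exact hw (h ▸ fst_mem_labels he)
  rw [value, hout, hinn, Finset.prod_singleton, Finset.prod_empty, flatValue_comp, flatValue_Rl,
    flatValue_of_notMem a b hw, key, mul_one, one_mul, one_mul]

end Value

end LSeq

/-- The class of a translation `D^w_1(λ)` is the value of `λ` at `w`. -/
lemma DT1.exists_value_eq (P : Set (Fm × List Fm)) (H : Set DSeq) {s : LSeq} {w : Nat} {X : Str}
    (h : DT1 s w X) :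
    ∃ N, ∀ n ≥ N, ∀ D : Finset Nat, (∀ x ∈ s.labels, x ≠ w → x ∉ D) →
      s.value (fun A => AntQuot.mk P H (.fm A)) (fun A => AntQuot.mk P H (.star (.fm A)))
        AntQuot.future AntQuot.past n D w = AntQuot.mk P H X := by
  induction h with
  | flat w hX hY =>
    refine ⟨1, fun n hn D _ => ?_⟩
    obtain ⟨n, rfl⟩ := Nat.exists_eq_add_of_le' hn
    simp [LSeq.value, LSeq.flatValue, Multiset.filter_map, AntQuot.mk_comp,
      AntQuot.mk_of_isComp hX, AntQuot.mk_star_of_isComp hY]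
  | @out s t w u X Y _ _ hwu hw hu hst ihs iht =>
    obtain ⟨N₁, h₁⟩ := ihs
    obtain ⟨N₂, h₂⟩ := iht
    refine ⟨N₁ + N₂ + 1, fun n hn D hD => ?_⟩
    obtain ⟨n, rfl⟩ := Nat.exists_eq_add_of_le' (le_of_add_le_right hn)
    simp only [LSeq.labels_comp, LSeq.labels_Rl, Finset.mem_union, Finset.mem_insert,
      Finset.mem_singleton] at hD
    have hlab : s.labels ∩ ((Rl w u).comp t).labels ⊆ {w} := by
      intro x hx
      simp only [LSeq.labels_comp, LSeq.labels_Rl, Finset.mem_inter, Finset.mem_union,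
        Finset.mem_insert, Finset.mem_singleton] at hx ⊢
      rcases hx with ⟨hx, (rfl | rfl) | hx'⟩
      · rfl
      · exact absurd hx hu
      · exact absurd (hst ▸ Finset.mem_inter.2 ⟨hx, hx'⟩) (Finset.notMem_empty _)
    rw [LSeq.value_comp _ _ _ _ hlab,
      LSeq.value_Rl_comp_out _ _ _ _ hwu hw (hD u (by simp) hwu.symm),
      h₁ _ (by omega) D fun x hx => hD x (.inl hx),
      h₂ n (by omega) (insert w D), AntQuot.mk_comp, AntQuot.mk_dia]
    intro x hx _ hxD
    have hxw : x ≠ w := fun e => hw (e ▸ hx)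
    exact hD x (.inr (.inr hx)) hxw ((Finset.mem_insert.1 hxD).resolve_left hxw)
  | @inn s t w v X Y _ _ hwv hw hv hst ihs iht =>
    obtain ⟨N₁, h₁⟩ := ihs
    obtain ⟨N₂, h₂⟩ := iht
    refine ⟨N₁ + N₂ + 1, fun n hn D hD => ?_⟩
    obtain ⟨n, rfl⟩ := Nat.exists_eq_add_of_le' (le_of_add_le_right hn)
    simp only [LSeq.labels_comp, LSeq.labels_Rl, Finset.mem_union, Finset.mem_insert,
      Finset.mem_singleton] at hD
    have hlab : s.labels ∩ ((Rl v w).comp t).labels ⊆ {w} := by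
      intro x hx
      simp only [LSeq.labels_comp, LSeq.labels_Rl, Finset.mem_inter, Finset.mem_union,
        Finset.mem_insert, Finset.mem_singleton] at hx ⊢
      rcases hx with ⟨hx, (rfl | rfl) | hx'⟩
      · exact absurd hx hv
      · rfl
      · exact absurd (hst ▸ Finset.mem_inter.2 ⟨hx, hx'⟩) (Finset.notMem_empty _)
    rw [LSeq.value_comp _ _ _ _ hlab,
      LSeq.value_Rl_comp_inn _ _ _ _ hwv hw (hD v (by simp) hwv.symm),
      h₁ _ (by omega) D fun x hx => hD x (.inl hx),
      h₂ n (by omega) (insert w D), AntQuot.mk_comp, AntQuot.mk_bullet]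
    intro x hx _ hxD
    have hxw : x ≠ w := fun e => hw (e ▸ hx)
    exact hD x (.inr (.inr hx)) hxw ((Finset.mem_insert.1 hxD).resolve_left hxw)
  | glue _ _ hst ihs iht =>
    obtain ⟨N₁, h₁⟩ := ihs
    obtain ⟨N₂, h₂⟩ := iht
    refine ⟨N₁ + N₂ + 1, fun n hn D hD => ?_⟩
    obtain ⟨n, rfl⟩ := Nat.exists_eq_add_of_le' (le_of_add_le_right hn)
    simp only [LSeq.labels_comp, Finset.mem_union] at hD
    rw [LSeq.value_comp _ _ _ _ hst, h₁ _ (by omega) D fun x hx => hD x (.inl hx),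
      h₂ _ (by omega) D fun x hx => hD x (.inr hx), AntQuot.mk_comp]

/-- All translations `D^w_1(λ)` are interderivable in antecedent position. -/
lemma DT1.mk_eq (P : Set (Fm × List Fm)) (H : Set DSeq) {s : LSeq} {w : Nat} {X Y : Str}
    (hX : DT1 s w X) (hY : DT1 s w Y) : AntQuot.mk P H X = AntQuot.mk P H Y := by
  obtain ⟨N₁, h₁⟩ := hX.exists_value_eq P H
  obtain ⟨N₂, h₂⟩ := hY.exists_value_eq P H
  rw [← h₁ (N₁ + N₂) (by omega) ∅ (by simp), h₂ (N₁ + N₂) (by omega) ∅ (by simp)]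

lemma WPart.derivable_iff (P : Set (Fm × List Fm)) (H : Set DSeq)
    {lam s t s' t' : LSeq} {w : Nat} {X Y X' Y' : Str}
    (h₁ : WPart lam s t w) (h₂ : WPart lam s' t' w)
    (hX : DT1 s w X) (hY : DT2 t w Y) (hX' : DT1 s' w X') (hY' : DT2 t' w Y') :
    DPH P H ⟨X, Y⟩ ↔ DPH P H ⟨X', Y'⟩ := by
  obtain ⟨Z, hZ, eZ⟩ := AntQuot.exists_dt1_of_dt2 (P := P) (H := H) hY
  obtain ⟨Z', hZ', eZ'⟩ := AntQuot.exists_dt1_of_dt2 (P := P) (H := H) hY'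
  have hl := hX.glue hZ h₁.2.2.2.subset
  have hl' := hX'.glue hZ' h₂.2.2.2.subset
  rw [← h₁.1] at hl
  rw [← h₂.1] at hl'
  rw [DPH.iff_comp_star_I, DPH.iff_comp_star_I (X := X')]
  refine AntQuot.mk_eq_iff.1 ?_ _
  rw [AntQuot.mk_comp, AntQuot.mk_comp, eZ, eZ']
  exact hl.mk_eq P H hl'

/-- For any two `w`-partitions of a labeled polytree sequent `λ` with
`w` occurring in `λ`, the corresponding display translations `D_w(λ)` are deductively
equivalent, i.e. mutually derivable from one another in `DKtP`. -/
theorem dtrans_partition_invariance (P : Set (Fm × List Fm)) (hP : ValidAxSet P)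
    (lam : LSeq) (hpt : IsPolytree lam) (w : Nat) (hw : w ∈ lam.labels)
    (s t s' t' : LSeq) (X Y X' Y' : Str)
    (h1 : WPart lam s t w) (h2 : WPart lam s' t' w)
    (hX : DT1 s w X) (hY : DT2 t w Y) (hX' : DT1 s' w X') (hY' : DT2 t' w Y') :
    DPH P {⟨X, Y⟩} ⟨X', Y'⟩ ∧ DPH P {⟨X', Y'⟩} ⟨X, Y⟩ := by
  exact ⟨(h1.derivable_iff P _ h2 hX hY hX' hY').1 (.hyp rfl),
    (h1.derivable_iff P _ h2 hX hY hX' hY').2 (.hyp rfl)⟩
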